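/- Let M ∈ ℕ, W ⊂ ℝ^{3+2M} open, and R : W → ℝ smooth. If every smooth solution (x(·), y(·), z(·)) of the equation ż = h(x,y,z,ẏ−zẋ) + g(x,y,z,ẏ−zẋ)·ẋ, defined on an interval I with (z(t), x(t), …, x^{(M)}(t), y(t), …, y^{(M)}(t)) ∈ W for all t ∈ I, satisfies R(z(t), x(t), …, x^{(M)}(t), y(t), …, y^{(M)}(t)) = 0 identically on I, then R is identically zero on W. -/

import Mathlib

open Set

/-- A smooth vector field on an open set has a smooth local integral curve through each point. -/
theorem exists_contDiffOn_integralCurve {E : Type*} [NormedAddCommGroup E] [NormedSpace ℝ E]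
    [CompleteSpace E] {v : E → E} {U : Set E} (hU : IsOpen U)
    (hv : ContDiffOn ℝ (⊤ : ℕ∞) v U) {x₀ : E} (hx₀ : x₀ ∈ U) :
    ∃ ε > 0, ∃ α : ℝ → E, α 0 = x₀ ∧ ContDiffOn ℝ (⊤ : ℕ∞) α (Ioo (-ε) ε) ∧
      ∀ t ∈ Ioo (-ε) ε, α t ∈ U ∧ HasDerivAt α (v (α t)) t := by
  have hv₁ : ContDiffAt ℝ 1 v x₀ :=
    (hv.contDiffAt (hU.mem_nhds hx₀)).of_le (by exact_mod_cast le_top)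
  obtain ⟨α, hα₀, ε, hε, hα⟩ :=
    hv₁.exists_forall_mem_closedBall_exists_eq_forall_mem_Ioo_hasDerivAt₀ 0
  simp only [zero_sub, zero_add] at hα
  have hcont : ContinuousAt α 0 := (hα 0 ⟨by linarith, hε⟩).continuousAt
  obtain ⟨δ, hδ, hδU⟩ := Metric.mem_nhds_iff.1
    (hcont.preimage_mem_nhds (by rw [hα₀]; exact hU.mem_nhds hx₀))
  have hη : 0 < min ε δ / 2 := by positivity
  have hsub : ∀ t ∈ Icc (-(min ε δ / 2)) (min ε δ / 2), α t ∈ U ∧ HasDerivAt α (v (α t)) t := by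
    intro t ht
    have h₁ := min_le_left ε δ
    have h₂ := min_le_right ε δ
    refine ⟨hδU ?_, hα t ⟨by linarith [ht.1], by linarith [ht.2]⟩⟩
    rw [Metric.mem_ball, Real.dist_eq, sub_zero, abs_lt]
    exact ⟨by linarith [ht.1], by linarith [ht.2]⟩
  refine ⟨min ε δ / 2, hη, α, hα₀, ?_, fun t ht ↦ hsub t (Ioo_subset_Icc_self ht)⟩
  refine (ODE.contDiffOn_enat_Icc_of_hasDerivWithinAt (f := fun _ ↦ v) (u := U) ?_
    (fun t ht ↦ (hsub t ht).2.hasDerivWithinAt) (fun t ht ↦ (hsub t ht).1)).mono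
    Ioo_subset_Icc_self
  exact hv.comp contDiff_snd.contDiffOn fun q hq ↦ hq.2

/-- A smooth scalar time-dependent differential equation has a smooth local solution through each
point of its domain. -/
theorem exists_contDiffOn_solution {F : ℝ × ℝ → ℝ} {V : Set (ℝ × ℝ)} (hV : IsOpen V)
    (hF : ContDiffOn ℝ (⊤ : ℕ∞) F V) {z₀ : ℝ} (hz₀ : (0, z₀) ∈ V) :
    ∃ ε > 0, ∃ z : ℝ → ℝ, z 0 = z₀ ∧ ContDiffOn ℝ (⊤ : ℕ∞) z (Ioo (-ε) ε) ∧
      ∀ t ∈ Ioo (-ε) ε, (t, z t) ∈ V ∧ HasDerivAt z (F (t, z t)) t := by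
  obtain ⟨ε, hε, α, hα₀, hα, hαV⟩ := exists_contDiffOn_integralCurve (v := fun q ↦ (1, F q)) hV
    (contDiffOn_const.prodMk hF) hz₀
  have hfst : ∀ t ∈ Ioo (-ε) ε, (α t).1 = t := by
    have hd : ∀ t ∈ Ioo (-ε) ε, HasDerivAt (fun s ↦ (α s).1 - s) 0 t := fun t ht ↦ by
      have h₁ : HasDerivAt (fun s ↦ (α s).1) 1 t := (hαV t ht).2.fst
      simpa using h₁.fun_sub (hasDerivAt_id' t)
    intro t ht
    have := isOpen_Ioo.is_const_of_deriv_eq_zero isPreconnected_Ioo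
      (fun s hs ↦ (hd s hs).differentiableAt.differentiableWithinAt)
      (fun s hs ↦ (hd s hs).deriv) ht (show (0 : ℝ) ∈ Ioo (-ε) ε from ⟨by linarith, hε⟩)
    simp only [hα₀] at this
    linarith
  refine ⟨ε, hε, fun t ↦ (α t).2, by simp [hα₀], hα.snd, fun t ht ↦ ?_⟩
  have heq : (t, (α t).2) = α t := Prod.ext (hfst t ht).symm rfl
  rw [heq]
  exact ⟨(hαV t ht).1, (hαV t ht).2.snd⟩

/-- Every finite jet at the origin is the jet of a smooth function. -/
theorem exists_contDiff_iteratedDeriv_eq {n : ℕ} (c : Fin n → ℝ) :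
    ∃ f : ℝ → ℝ, ContDiff ℝ (⊤ : ℕ∞) f ∧ ∀ i : Fin n, iteratedDeriv i f 0 = c i := by
  let p : Polynomial ℝ := ∑ i : Fin n, Polynomial.monomial i (c i / (i : ℕ).factorial)
  have hp : ∀ k, iteratedDeriv k (fun t ↦ p.eval t) =
      fun t ↦ (Polynomial.derivative^[k] p).eval t := by
    intro k
    induction k with
    | zero => simp
    | succ k ih =>
      rw [iteratedDeriv_succ, ih, Function.iterate_succ_apply']
      ext t
      exact Polynomial.deriv _
  refine ⟨fun t ↦ p.eval t, by simpa using p.contDiff_aeval (𝕜 := ℝ) (⊤ : ℕ∞), fun i ↦ ?_⟩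
  have hcoeff : p.coeff i = c i / (i : ℕ).factorial := by
    simp [p, Polynomial.finsetSum_coeff, Polynomial.coeff_monomial, Fin.val_inj]
  simp only [hp]
  rw [← Polynomial.coeff_zero_eq_eval_zero, Polynomial.coeff_iterate_derivative, zero_add,
    Nat.descFactorial_self, hcoeff, nsmul_eq_mul]
  field_simp

/-- Lemma 2.1 of the paper: if a smooth function `R` of the jet
`(z, x, …, x^{(M)}, y, …, y^{(M)})` vanishes along every smooth solution of
`ż = h(x,y,z,ẏ−zẋ) + g(x,y,z,ẏ−zẋ)·ẋ` whose jet stays in the open set `W`,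
then `R` vanishes identically on `W`. -/
theorem stmt1 (M : ℕ) (hM : 1 ≤ M)
    (Ω : Set (ℝ × ℝ × ℝ × ℝ)) (hΩ : IsOpen Ω)
    (g h : ℝ × ℝ × ℝ × ℝ → ℝ)
    (hg : ContDiffOn ℝ (⊤ : ℕ∞) g Ω) (hh : ContDiffOn ℝ (⊤ : ℕ∞) h Ω)
    (W : Set (ℝ × (Fin (M + 1) → ℝ) × (Fin (M + 1) → ℝ))) (hW : IsOpen W)
    (hWΩ : ∀ p ∈ W,
      (p.2.1 ⟨0, Nat.succ_pos M⟩, p.2.2 ⟨0, Nat.succ_pos M⟩, p.1,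
        p.2.2 ⟨1, by omega⟩ - p.1 * p.2.1 ⟨1, by omega⟩) ∈ Ω)
    (R : ℝ × (Fin (M + 1) → ℝ) × (Fin (M + 1) → ℝ) → ℝ)
    (hR : ContDiffOn ℝ (⊤ : ℕ∞) R W)
    (hvan : ∀ (x y z : ℝ → ℝ) (a b : ℝ),
      ContDiff ℝ (⊤ : ℕ∞) x → ContDiff ℝ (⊤ : ℕ∞) y → ContDiffOn ℝ (⊤ : ℕ∞) z (Ioo a b) →
      (∀ t ∈ Ioo a b,
        (z t, fun i : Fin (M + 1) => iteratedDeriv i.1 x t,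
          fun i : Fin (M + 1) => iteratedDeriv i.1 y t) ∈ W) →
      (∀ t ∈ Ioo a b, (x t, y t, z t, deriv y t - z t * deriv x t) ∈ Ω) →
      (∀ t ∈ Ioo a b, deriv z t =
          h (x t, y t, z t, deriv y t - z t * deriv x t) +
            g (x t, y t, z t, deriv y t - z t * deriv x t) * deriv x t) →
      ∀ t ∈ Ioo a b,
        R (z t, fun i : Fin (M + 1) => iteratedDeriv i.1 x t,
            fun i : Fin (M + 1) => iteratedDeriv i.1 y t) = 0) :
    ∀ p ∈ W, R p = 0 := by
  intro p hp
  obtain ⟨x, hx, hxp⟩ := exists_contDiff_iteratedDeriv_eq p.2.1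
  obtain ⟨y, hy, hyp⟩ := exists_contDiff_iteratedDeriv_eq p.2.2
  let J : ℝ × ℝ → ℝ × (Fin (M + 1) → ℝ) × (Fin (M + 1) → ℝ) := fun q ↦
    (q.2, fun i ↦ iteratedDeriv i x q.1, fun i ↦ iteratedDeriv i y q.1)
  have hJ : Continuous J := by
    refine continuous_snd.prodMk ((continuous_pi fun i ↦ ?_).prodMk (continuous_pi fun i ↦ ?_))
    · exact (hx.continuous_iteratedDeriv i (by exact_mod_cast le_top)).comp continuous_fst
    · exact (hy.continuous_iteratedDeriv i (by exact_mod_cast le_top)).comp continuous_fst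
  have hJ₀ : J (0, p.1) = p := Prod.ext rfl (Prod.ext (funext hxp) (funext hyp))
  let A : ℝ × ℝ → ℝ × ℝ × ℝ × ℝ := fun q ↦
    (x q.1, y q.1, q.2, deriv y q.1 - q.2 * deriv x q.1)
  have hderiv : ∀ {f : ℝ → ℝ}, ContDiff ℝ (⊤ : ℕ∞) f →
      ContDiff ℝ (⊤ : ℕ∞) fun q : ℝ × ℝ ↦ deriv f q.1 := fun hf ↦
    (contDiff_infty_iff_deriv.1 hf).2.comp contDiff_fst
  have hA : ContDiff ℝ (⊤ : ℕ∞) A :=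
    (hx.comp contDiff_fst).prodMk ((hy.comp contDiff_fst).prodMk
      (contDiff_snd.prodMk ((hderiv hy).sub (contDiff_snd.mul (hderiv hx)))))
  have hAΩ : ∀ q, J q ∈ W → A q ∈ Ω := fun q hq ↦ by
    simpa [J, A] using hWΩ _ hq
  have hF : ContDiffOn ℝ (⊤ : ℕ∞) (fun q ↦ h (A q) + g (A q) * deriv x q.1) (J ⁻¹' W) :=
    (hh.comp hA.contDiffOn hAΩ).add ((hg.comp hA.contDiffOn hAΩ).mul (hderiv hx).contDiffOn)
  obtain ⟨ε, hε, z, hz₀, hz, hsol⟩ := exists_contDiffOn_solution (hW.preimage hJ) hF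
    (show J (0, p.1) ∈ W by rwa [hJ₀])
  have hR₀ := hvan x y z (-ε) ε hx hy hz (fun t ht ↦ (hsol t ht).1)
    (fun t ht ↦ hAΩ _ (hsol t ht).1) (fun t ht ↦ (hsol t ht).2.deriv) 0 ⟨by linarith, hε⟩
  have hp₀ : R (J (0, z 0)) = 0 := hR₀
  rwa [hz₀, hJ₀] at hp₀
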